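/- Let R be a commutative integral domain (with 1 ≠ 0) and let 𝓡 be the set of all 7×7 matrices over R (rows and columns indexed 0,…,6) of the form: all diagonal entries equal to a common α ∈ R; entries (0,1)=a, (0,2)=b, (0,3)=c, (0,4)=d, (0,5)=e, (0,6)=f for a,b,c,d,e,f ∈ R; entry (1,3)=b; entry (1,6)=d; entry (2,6)=e; entry (4,6)=a; entry (5,6)=b; all other off-diagonal entries zero. Then 𝓡 is a subring of the matrix ring M₇(R) and 𝓡 is a centrally essential ring. -/

import Mathlib

/-- A ring `S` is *centrally essential* if for every nonzero `a : S` there exist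
nonzero central elements `x, y` with `a * x = y`. -/
def IsCentrallyEssential (S : Type*) [Ring S] : Prop :=
  ∀ a : S, a ≠ 0 → ∃ x y : S, x ∈ Subring.center S ∧ y ∈ Subring.center S ∧
    x ≠ 0 ∧ y ≠ 0 ∧ a * x = y

/-- The matrix of Example 2.4: diagonal `α`, first row `(α, a, b, c, d, e, f)`,
entries `(1,3) = b`, `(1,6) = d`, `(2,6) = e`, `(4,6) = a`, `(5,6) = b`, other
off-diagonal entries zero. -/
def exMat {R : Type*} [CommRing R] (α a b c d e f : R) : Matrix (Fin 7) (Fin 7) R :=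
  !![α, a, b, c, d, e, f;
     0, α, 0, b, 0, 0, d;
     0, 0, α, 0, 0, 0, e;
     0, 0, 0, α, 0, 0, 0;
     0, 0, 0, 0, α, 0, a;
     0, 0, 0, 0, 0, α, b;
     0, 0, 0, 0, 0, 0, α]

/-- The set of all matrices of the form `exMat α a b c d e f`. -/
def exSet (R : Type*) [CommRing R] : Set (Matrix (Fin 7) (Fin 7) R) :=
  {M | ∃ α a b c d e f : R, M = exMat α a b c d e f}

section ExMat

variable {R : Type*} [CommRing R]

theorem exMat_mul (α a b c d e f α' a' b' c' d' e' f' : R) :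
    exMat α a b c d e f * exMat α' a' b' c' d' e' f' =
      exMat (α * α') (α * a' + a * α') (α * b' + b * α') (α * c' + a * b' + c * α')
        (α * d' + d * α') (α * e' + e * α')
        (α * f' + a * d' + b * e' + d * a' + e * b' + f * α') := by
  ext i j
  fin_cases i <;> fin_cases j <;>
    simp [exMat, Matrix.mul_apply, Fin.sum_univ_succ] <;> ring

theorem exMat_add (α a b c d e f α' a' b' c' d' e' f' : R) :
    exMat α a b c d e f + exMat α' a' b' c' d' e' f' =
      exMat (α + α') (a + a') (b + b') (c + c') (d + d') (e + e') (f + f') := by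
  simp [exMat]

theorem exMat_neg (α a b c d e f : R) :
    -exMat α a b c d e f = exMat (-α) (-a) (-b) (-c) (-d) (-e) (-f) := by
  simp [exMat]

theorem exMat_zero : exMat (0 : R) 0 0 0 0 0 0 = 0 := by
  ext i j
  fin_cases i <;> fin_cases j <;> rfl

theorem exMat_one : exMat (1 : R) 0 0 0 0 0 0 = 1 := by
  ext i j
  fin_cases i <;> fin_cases j <;> rfl

theorem exMat_ne_zero_of_last {α a b c d e f : R} (hf : f ≠ 0) :
    exMat α a b c d e f ≠ 0 :=
  fun h ↦ hf (congrFun (congrFun h 0) 6)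

theorem exMat_commute (α c d e f α' a' b' c' d' e' f' : R) :
    Commute (exMat α 0 0 c d e f) (exMat α' a' b' c' d' e' f') := by
  rw [Commute, SemiconjBy, exMat_mul, exMat_mul]
  congr 1 <;> ring

variable (R) in
/-- The subring of `M₇(R)` whose underlying set is `exSet R`. -/
def exSubring : Subring (Matrix (Fin 7) (Fin 7) R) where
  carrier := exSet R
  mul_mem' := by
    rintro _ _ ⟨α, a, b, c, d, e, f, rfl⟩ ⟨α', a', b', c', d', e', f', rfl⟩
    exact ⟨_, _, _, _, _, _, _, exMat_mul ..⟩
  one_mem' := ⟨_, _, _, _, _, _, _, exMat_one.symm⟩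
  add_mem' := by
    rintro _ _ ⟨α, a, b, c, d, e, f, rfl⟩ ⟨α', a', b', c', d', e', f', rfl⟩
    exact ⟨_, _, _, _, _, _, _, exMat_add ..⟩
  zero_mem' := ⟨_, _, _, _, _, _, _, exMat_zero.symm⟩
  neg_mem' := by
    rintro _ ⟨α, a, b, c, d, e, f, rfl⟩
    exact ⟨_, _, _, _, _, _, _, exMat_neg ..⟩

theorem exMat_mem_exSubring (α a b c d e f : R) : exMat α a b c d e f ∈ exSubring R :=
  ⟨_, _, _, _, _, _, _, rfl⟩

theorem exMat_mem_center (α c d e f : R) :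
    (⟨exMat α 0 0 c d e f, exMat_mem_exSubring ..⟩ : exSubring R) ∈
      Subring.center (exSubring R) := by
  rw [Subring.mem_center_iff]
  rintro ⟨_, α', a', b', c', d', e', f', rfl⟩
  exact Subtype.ext (exMat_commute ..).symm.eq

/-- Multiplying by a suitable central matrix moves any of `α`, `a`, `b` into the corner. -/
theorem exists_central_mul_exMat {α a b c d e f : R} (h : exMat α a b c d e f ≠ 0) :
    ∃ α₁ c₁ d₁ e₁ f₁ α₂ c₂ d₂ e₂ f₂ : R,
      exMat α₂ 0 0 c₂ d₂ e₂ f₂ ≠ 0 ∧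
        exMat α a b c d e f * exMat α₁ 0 0 c₁ d₁ e₁ f₁ = exMat α₂ 0 0 c₂ d₂ e₂ f₂ := by
  by_cases hα : α = 0
  · by_cases ha : a = 0
    · by_cases hb : b = 0
      · subst ha hb
        exact ⟨1, 0, 0, 0, 0, α, c, d, e, f, h, by rw [exMat_one, mul_one]⟩
      · exact ⟨0, 0, 0, 1, 0, 0, 0, 0, 0, b, exMat_ne_zero_of_last hb, by
          rw [exMat_mul]; simp [hα]⟩
    · exact ⟨0, 0, 1, 0, 0, 0, 0, 0, 0, a, exMat_ne_zero_of_last ha, by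
        rw [exMat_mul]; simp [hα]⟩
  · exact ⟨0, 0, 0, 0, 1, 0, 0, 0, 0, α, exMat_ne_zero_of_last hα, by
      rw [exMat_mul]; simp⟩

theorem isCentrallyEssential_exSubring : IsCentrallyEssential (exSubring R) := by
  rintro ⟨_, α, a, b, c, d, e, f, rfl⟩ h
  obtain ⟨α₁, c₁, d₁, e₁, f₁, α₂, c₂, d₂, e₂, f₂, hy, hxy⟩ :=
    exists_central_mul_exMat fun h0 ↦ h (Subtype.ext h0)
  refine ⟨_, _, exMat_mem_center α₁ c₁ d₁ e₁ f₁, exMat_mem_center α₂ c₂ d₂ e₂ f₂,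
    fun hx ↦ hy ?_, fun h0 ↦ hy (congrArg Subtype.val h0), Subtype.ext hxy⟩
  have hx' : exMat α₁ 0 0 c₁ d₁ e₁ f₁ = 0 := congrArg Subtype.val hx
  rw [← hxy, hx', mul_zero]

end ExMat

/-- Example 2.4 (first part): over a commutative domain `R`, the set of matrices
`exMat α a b c d e f` forms a subring `𝓡` of `M₇(R)`, and `𝓡` is a centrally
essential ring. -/
theorem exSet_is_centrallyEssential_subring
    (R : Type*) [CommRing R] [IsDomain R] :
    ∃ 𝓡 : Subring (Matrix (Fin 7) (Fin 7) R),
      (𝓡 : Set (Matrix (Fin 7) (Fin 7) R)) = exSet R ∧ IsCentrallyEssential 𝓡 :=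
  ⟨exSubring R, rfl, isCentrallyEssential_exSubring⟩
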